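/- arXiv:2310.18714 — 2 statements merged into one kernel-verified Lean document; each statement's English description precedes it below -/
import Mathlib

section
/- The concrete update operator ▽₁ on the frame E₁ satisfies postulate (Lex▽): for all states (B, r) ∈ E₁ and all φ, ψ ⊆ W, if ψ ∩ φ ≠ ∅ then Bel(((B, r) ▽₁ φ) ▽₁ ψ) ⊆ φ. -/
/-- A preorder on `W` given as a binary relation: reflexive and transitive. -/
def IsPreorderRel {W : Type*} (R : W → W → Prop) : Prop :=
  (∀ x, R x x) ∧ (∀ x y z, R x y → R y z → R x z)

/-- The strict part of a relation. -/
def strictLt {W : Type*} (R : W → W → Prop) (x y : W) : Prop := R x y ∧ ¬ R y x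

/-- The minimal elements of `N` w.r.t. the relation `R`. -/
def minSet {W : Type*} (N : Set W) (R : W → W → Prop) : Set W :=
  {x | x ∈ N ∧ ∀ y ∈ N, ¬ strictLt R y x}

/-- `R` is faithful to `w` iff `w` is strictly below every other world. -/
def FaithfulTo {W : Type*} (R : W → W → Prop) (w : W) : Prop :=
  ∀ w', w' ≠ w → strictLt R w w'

/-- A belief state of the concrete frame `E₁`: a belief set `B` together with an
assignment `r` of a preorder to each world, faithful to `w` whenever `w ∈ B`. -/
structure State1 (W : Type*) where
  B : Set W
  r : W → (W → W → Prop)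
  pre : ∀ w, IsPreorderRel (r w)
  faith : ∀ w ∈ B, FaithfulTo (r w) w

open Classical in
/-- The level of a world in the three-tier hierarchy determined by `w'` and `φ`. -/
noncomputable def levelOf {W : Type*} (w' : W) (φ : Set W) (x : W) : ℕ :=
  if x = w' then 0 else if x ∈ φ then 1 else 2

/-- The three-tier hierarchy preorder `H(w', φ)`. -/
def hier {W : Type*} (w' : W) (φ : Set W) : W → W → Prop :=
  fun x y => levelOf w' φ x ≤ levelOf w' φ y

theorem hier_pre {W : Type*} (w' : W) (φ : Set W) : IsPreorderRel (hier w' φ) :=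
  ⟨fun _ => le_refl _, fun _ _ _ h1 h2 => le_trans h1 h2⟩

theorem hier_faithful {W : Type*} (w' : W) (φ : Set W) :
    FaithfulTo (hier w' φ) w' := by
  intro x hx
  have h0 : levelOf w' φ w' = 0 := by simp [levelOf]
  have h1 : 0 < levelOf w' φ x := by
    unfold levelOf
    split
    · exact absurd ‹x = w'› hx
    · split <;> omega
  constructor
  · show levelOf w' φ w' ≤ levelOf w' φ x
    rw [h0]; exact Nat.zero_le _
  · show ¬ levelOf w' φ x ≤ levelOf w' φ w'
    rw [h0]; omega

/-- The concrete update operator `▽₁`. -/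
noncomputable def upd1 {W : Type*} (S : State1 W) (φ : Set W) : State1 W where
  B := ⋃ w ∈ S.B, minSet φ (S.r w)
  r := fun w' => hier w' φ
  pre := fun w' => hier_pre w' φ
  faith := fun w' _ => hier_faithful w' φ

theorem levelOf_le_one {W : Type*} {w' : W} {φ : Set W} {x : W} (hx : x ∈ φ) :
    levelOf w' φ x ≤ 1 := by
  unfold levelOf
  split_ifs <;> omega

theorem levelOf_of_notMem {W : Type*} {w' : W} {φ : Set W} {x : W} (hw : w' ∈ φ)
    (hx : x ∉ φ) : levelOf w' φ x = 2 := by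
  have hne : x ≠ w' := fun h => hx (h ▸ hw)
  simp [levelOf, hne, hx]

theorem strictLt_hier_of_mem_of_notMem {W : Type*} {w' : W} {φ : Set W} {x y : W}
    (hw : w' ∈ φ) (hy : y ∈ φ) (hx : x ∉ φ) : strictLt (hier w' φ) y x := by
  have hy1 := levelOf_le_one (w' := w') hy
  have hx2 := levelOf_of_notMem hw hx
  unfold strictLt hier
  omega

theorem upd1_B_subset {W : Type*} (S : State1 W) (φ : Set W) : (upd1 S φ).B ⊆ φ :=
  Set.iUnion₂_subset fun _ _ _ hx => hx.1

theorem upd1_satisfies_Lex {W : Type*} [Fintype W] (S : State1 W) (φ ψ : Set W)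
    (h : ψ ∩ φ ≠ ∅) : (upd1 (upd1 S φ) ψ).B ⊆ φ := by
  obtain ⟨y, hyψ, hyφ⟩ := Set.nonempty_iff_ne_empty.mpr h
  refine Set.iUnion₂_subset fun w hw x hx => ?_
  by_contra hxφ
  exact hx.2 y hyψ (strictLt_hier_of_mem_of_notMem (upd1_B_subset S φ hw) hyφ hxφ)
end

section
/- Let W = Fin 8 with distinct elements w₁, …, w₈, and let R₁, R₂ be the specified linear preorders faithful to w₁ and w₂ respectively. For every update frame (E, Bel, ▽) over W and every faithful collective assignment f that represents ▽, if there exists a state S₀ ∈ E with Bel S₀ = {w₁, w₂}, f S₀ w₁ = R₁ and f S₀ w₂ = R₂, then ▽ does not satisfy postulate (Nat▽). (Hence no update operator satisfies (U1▽)–(U8▽) together with (Nat▽) on a frame containing such a state.) -/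
/-- A faithful collective assignment for the frame `(E, Bel)`. -/
def FaithfulCollective {W E : Type*} (Bel : E → Set W)
    (f : E → W → (W → W → Prop)) : Prop :=
  ∀ S : E, ∀ w ∈ Bel S,
    IsPreorderRel (f S w) ∧ FaithfulTo (f S w) w ∧
    ∃ S' : E, Bel S' = {w} ∧ f S' w = f S w

/-- The assignment `f` represents the update operator `upd`. -/
def Represents {W E : Type*} (Bel : E → Set W) (upd : E → Set W → E)
    (f : E → W → (W → W → Prop)) : Prop :=
  ∀ (S : E) (φ : Set W), Bel (upd S φ) = ⋃ w ∈ Bel S, minSet φ (f S w)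

/-- Postulate (Nat▽). -/
def PostNat {W E : Type*} (Bel : E → Set W) (upd : E → Set W → E) : Prop :=
  ∀ (S : E) (φ ψ : Set W), Bel (upd S φ) ∩ ψ = ∅ → Bel (upd (upd S φ) ψ) = Bel (upd S ψ)

/-- The rank of each world in the list `w₁, w₂, w₃, w₄, w₆, w₅, w₇, w₈`
(worlds `w₁, …, w₈` are `0, …, 7 : Fin 8`). -/
def rank1 : Fin 8 → ℕ := ![0, 1, 2, 3, 5, 4, 6, 7]

/-- The rank of each world in the list `w₂, w₁, w₃, w₅, w₆, w₄, w₇, w₈`. -/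
def rank2 : Fin 8 → ℕ := ![1, 0, 2, 5, 3, 4, 6, 7]

/-- The linear preorder determined by the list `w₁, w₂, w₃, w₄, w₆, w₅, w₇, w₈`. -/
def Rel1 : Fin 8 → Fin 8 → Prop := fun x y => rank1 x ≤ rank1 y

/-- The linear preorder determined by the list `w₂, w₁, w₃, w₅, w₆, w₄, w₇, w₈`. -/
def Rel2 : Fin 8 → Fin 8 → Prop := fun x y => rank2 x ≤ rank2 y

theorem mem_minSet_triple_of_pairs {W : Type*} {R : W → W → Prop} {a b c : W}
    (ha : c ∈ minSet {a, c} R) (hb : c ∈ minSet {b, c} R) : c ∈ minSet {a, b, c} R := by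
  refine ⟨by simp, ?_⟩
  rintro y (rfl | rfl | rfl)
  · exact ha.2 _ (by simp)
  · exact hb.2 _ (by simp)
  · exact ha.2 _ (by simp)

theorem minSet_singleton {W : Type*} (R : W → W → Prop) (a : W) : minSet {a} R = {a} := by
  ext x
  simp only [minSet, strictLt, Set.mem_ofPred_eq, Set.mem_singleton_iff, forall_eq]
  exact ⟨And.left, fun h => ⟨h, fun hlt => hlt.2 (h ▸ hlt.1)⟩⟩

theorem no_operator_Nat {E : Type*} (Bel : E → Set (Fin 8)) (upd : E → Set (Fin 8) → E)
    (f : E → Fin 8 → (Fin 8 → Fin 8 → Prop))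
    (hf : FaithfulCollective Bel f) (hrep : Represents Bel upd f)
    (S₀ : E) (hB : Bel S₀ = {(0 : Fin 8), (1 : Fin 8)})
    (h1 : f S₀ 0 = Rel1) (h2 : f S₀ 1 = Rel2) :
    ¬ PostNat Bel upd := by
  intro hNat
  have hS : ∀ φ, Bel (upd S₀ φ) = minSet φ Rel1 ∪ minSet φ Rel2 := by
    intro φ
    rw [hrep, hB, Set.biUnion_pair, h1, h2]
  have hBel : Bel (upd S₀ {6}) = {6} := by simp [hS, minSet_singleton]
  -- A single relation must choose exactly as `Rel1` and `Rel2` jointly do away from world `6`.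
  have key : ∀ ψ : Set (Fin 8), 6 ∉ ψ →
      minSet ψ (f (upd S₀ {6}) 6) = minSet ψ Rel1 ∪ minSet ψ Rel2 := by
    intro ψ hψ
    have h := hNat S₀ {6} ψ (by rw [hBel]; simpa using hψ)
    rwa [hrep, hBel, Set.biUnion_singleton, hS] at h
  have h35 : (5 : Fin 8) ∈ minSet {3, 5} (f (upd S₀ {6}) 6) := by
    rw [key _ (by simp)]
    right
    simp [minSet, strictLt, Rel2, rank2]
  have h45 : (5 : Fin 8) ∈ minSet {4, 5} (f (upd S₀ {6}) 6) := by
    rw [key _ (by simp)]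
    left
    simp [minSet, strictLt, Rel1, rank1]
  have h345 := mem_minSet_triple_of_pairs h35 h45
  rw [key _ (by simp)] at h345
  simp [minSet, strictLt, Rel1, Rel2, rank1, rank2] at h345
end
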